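/- arXiv:math/0612080 — 5 statements merged into one kernel-verified Lean document; each statement's English description precedes it below -/
import Mathlib

section
/- The sequence w is cube-free: there exist no natural numbers i ≥ 0 and p ≥ 1 such that w(i + j) = w(i + j + p) for all 0 ≤ j < 2p (i.e., the infinite word w(0), w(1), w(2), … contains no factor of the form uuu with u a nonempty finite word). -/
/- The sign sequence w : ℕ → ℤ with w(0) = 1, w(3n) = 1, w(3n+1) = w(n),
   w(3n+2) = −1. -/
def signw : ℕ → ℤ
  | 0 => 1
  | (n+1) =>
    if (n+1) % 3 = 0 then 1
    else if (n+1) % 3 = 2 then -1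
    else signw ((n+1)/3)
decreasing_by exact Nat.div_lt_self (Nat.succ_pos n) (by norm_num)

theorem signw_three_mul (n : ℕ) : signw (3 * n) = 1 := by
  cases n with
  | zero => simp [signw]
  | succ n =>
    rw [show 3 * (n + 1) = (3 * n + 2) + 1 by ring, signw, if_pos (by omega)]

theorem signw_three_mul_add_one (n : ℕ) : signw (3 * n + 1) = signw n := by
  rw [signw, if_neg (by omega), if_neg (by omega), show (3 * n + 1) / 3 = n by omega]

theorem signw_three_mul_add_two (n : ℕ) : signw (3 * n + 2) = -1 := by
  rw [show 3 * n + 2 = (3 * n + 1) + 1 by ring, signw, if_neg (by omega), if_pos (by omega)]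

theorem signw_of_mod_eq_zero {n : ℕ} (h : n % 3 = 0) : signw n = 1 := by
  rw [show n = 3 * (n / 3) by omega, signw_three_mul]

theorem signw_of_mod_eq_two {n : ℕ} (h : n % 3 = 2) : signw n = -1 := by
  rw [show n = 3 * (n / 3) + 2 by omega, signw_three_mul_add_two]

/-- A cube of period `3 * q` restricts, along the positions `3 * m + 1`, to a cube of
period `q`. -/
theorem signw_cube_descent {i q : ℕ}
    (h : ∀ j < 2 * (3 * q), signw (i + j) = signw (i + j + 3 * q)) :
    ∀ j < 2 * q, signw ((i + 1) / 3 + j) = signw ((i + 1) / 3 + j + q) := by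
  intro j hj
  have key := h (3 * ((i + 1) / 3 + j) + 1 - i) (by omega)
  rwa [show i + (3 * ((i + 1) / 3 + j) + 1 - i) = 3 * ((i + 1) / 3 + j) + 1 by omega,
    show 3 * ((i + 1) / 3 + j) + 1 + 3 * q = 3 * ((i + 1) / 3 + j + q) + 1 by ring,
    signw_three_mul_add_one, signw_three_mul_add_one] at key

/-- The period of a cube in `signw` is a multiple of `3`. -/
theorem three_dvd_of_signw_cube {i p : ℕ} (hp : 1 ≤ p)
    (h : ∀ j < 2 * p, signw (i + j) = signw (i + j + p)) : 3 ∣ p := by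
  by_contra hdvd
  obtain rfl | hp2 : p = 1 ∨ 2 ≤ p := by omega
  · have h0 : signw i = signw (i + 1) := h 0 (by norm_num)
    have h1 : signw (i + 1) = signw (i + 2) := h 1 (by norm_num)
    obtain hi | hi | hi : i % 3 = 0 ∨ i % 3 = 1 ∨ i % 3 = 2 := by omega
    · have a := signw_of_mod_eq_zero hi
      have b := signw_of_mod_eq_two (n := i + 2) (by omega)
      omega
    · have a := signw_of_mod_eq_two (n := i + 1) (by omega)
      have b := signw_of_mod_eq_zero (n := i + 2) (by omega)
      omega
    · have a := signw_of_mod_eq_two hi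
      have b := signw_of_mod_eq_zero (n := i + 1) (by omega)
      omega
  · obtain hp3 | hp3 : p % 3 = 1 ∨ p % 3 = 2 := by omega
    · have key := h (2 - i % 3) (by omega)
      rw [signw_of_mod_eq_two (by omega), signw_of_mod_eq_zero (by omega)] at key
      norm_num at key
    · have key := h ((3 - i % 3) % 3) (by omega)
      rw [signw_of_mod_eq_zero (by omega), signw_of_mod_eq_two (by omega)] at key
      norm_num at key

/-- The sequence w is cube-free: there is no factor of the form uuu with u
    a nonempty finite word. -/
theorem stmt_1 :
    ¬ ∃ (i p : ℕ), 1 ≤ p ∧ ∀ j < 2 * p, signw (i + j) = signw (i + j + p) := by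
  rintro ⟨i, p, hp, h⟩
  induction p using Nat.strong_induction_on generalizing i with
  | _ p ih =>
    obtain ⟨q, rfl⟩ := three_dvd_of_signw_cube hp h
    exact ih q (by omega) _ (by omega) (signw_cube_descent h)
end

section
/- For every natural number n there exists a unique pair of natural numbers (p, q) such that p ∈ N₂, q ∈ N₂, p + q ∈ N₂ and p − q = n (as integers). -/
/- N₂: natural numbers all of whose ternary digits are 0 or 1. -/
def N2 (n : ℕ) : Prop := ∀ k : ℕ, (n / 3^k) % 3 ≤ 1

theorem N2_iff (n : ℕ) : N2 n ↔ n % 3 ≤ 1 ∧ N2 (n / 3) := by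
  have h_div (k : ℕ) : n / 3 ^ (k + 1) = n / 3 / 3 ^ k := by
    rw [Nat.div_div_eq_div_mul, pow_succ']
  constructor
  · intro h
    refine ⟨by simpa using h 0, fun k => ?_⟩
    rw [← h_div]
    exact h (k + 1)
  · rintro ⟨h0, h⟩ (_ | k)
    · simpa using h0
    · rw [h_div]
      exact h k

theorem N2_three_mul_add {n r : ℕ} (hn : N2 n) (hr : r ≤ 1) : N2 (3 * n + r) := by
  rw [N2_iff]
  have h_div : (3 * n + r) / 3 = n := by omega
  exact ⟨by omega, h_div.symm ▸ hn⟩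

theorem exists_N2_sub (n : ℕ) : ∃ p q : ℕ, N2 p ∧ N2 q ∧ N2 (p + q) ∧ p = n + q := by
  induction n using Nat.strong_induction_on with
  | _ n ih =>
    have step (m r s : ℕ) (hm : m < n) (hrs : r + s ≤ 1) (hn : 3 * m + r = n + s) :
        ∃ p q : ℕ, N2 p ∧ N2 q ∧ N2 (p + q) ∧ p = n + q := by
      obtain ⟨p, q, hp, hq, hpq, h⟩ := ih m hm
      refine ⟨3 * p + r, 3 * q + s, N2_three_mul_add hp (by omega),
        N2_three_mul_add hq (by omega), ?_, by omega⟩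
      rw [show 3 * p + r + (3 * q + s) = 3 * (p + q) + (r + s) by ring]
      exact N2_three_mul_add hpq hrs
    obtain rfl | hn := Nat.eq_zero_or_pos n
    · exact ⟨0, 0, by simp [N2]⟩
    · have h_cases : n % 3 = 0 ∨ n % 3 = 1 ∨ n % 3 = 2 := by omega
      rcases h_cases with h | h | h
      · exact step (n / 3) 0 0 (by omega) (by omega) (by omega)
      · exact step (n / 3) 1 0 (by omega) (by omega) (by omega)
      · exact step (n / 3 + 1) 0 1 (by omega) (by omega) (by omega)

theorem N2_sub_unique (p q p' q' : ℕ) (hp : N2 p) (hq : N2 q) (hpq : N2 (p + q))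
    (hp' : N2 p') (hq' : N2 q') (hpq' : N2 (p' + q')) (h : p + q' = p' + q) :
    p = p' ∧ q = q' := by
  by_cases h0 : p + q + p' + q' = 0
  · omega
  · rw [N2_iff] at hp hq hpq hp' hq' hpq'
    have h_div : (p + q) / 3 = p / 3 + q / 3 := by omega
    have h_div' : (p' + q') / 3 = p' / 3 + q' / 3 := by omega
    have ih := N2_sub_unique (p / 3) (q / 3) (p' / 3) (q' / 3) hp.2 hq.2 (h_div ▸ hpq.2)
      hp'.2 hq'.2 (h_div' ▸ hpq'.2) (by omega)
    omega
termination_by p + q + p' + q'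

/-- For every natural number n there is a unique pair (p, q) of natural numbers
    with p ∈ N₂, q ∈ N₂, p + q ∈ N₂ and p − q = n (as integers). -/
theorem stmt_6 :
    ∀ n : ℕ, ∃! pq : ℕ × ℕ, N2 pq.1 ∧ N2 pq.2 ∧ N2 (pq.1 + pq.2) ∧
      (pq.1 : ℤ) - (pq.2 : ℤ) = (n : ℤ) := by
  intro n
  obtain ⟨p, q, hp, hq, hpq, h⟩ := exists_N2_sub n
  refine ⟨(p, q), ⟨hp, hq, hpq, by simp [h]⟩, ?_⟩
  rintro ⟨p', q'⟩ ⟨hp', hq', hpq', h'⟩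
  dsimp only at hp' hq' hpq' h'
  exact Prod.ext_iff.mpr (N2_sub_unique p' q' p q hp' hq' hpq' hp hq hpq (by omega))
end

section
/- For every n ≥ 1 and every index i with 0 ≤ i < 3ⁿ − 1: if i is even then K_n[i+1] = a(K_n[i]), and if i is odd then K_n[i+1] = c(K_n[i]), where a = a_{01} and c = a_{12}. (Equivalently, K_n[i] = t_i(K_n[0]) where t_{2j} = (c∘a)^j and t_{2j+1} = a∘(c∘a)^j.) -/
/- a_{ij} : changes the first occurrence of i or j in a word to the other
   symbol; a = a_{01} = amap 0 1, c = a_{12} = amap 1 2. -/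
def amap (i j : Fin 3) : List (Fin 3) → List (Fin 3)
  | [] => []
  | x :: w => if x = i then j :: w else if x = j then i :: w else x :: amap i j w

/- The lists K_n of ternary words of length n: K_0 = [ε],
   K_{n+1} = (K_n · 0) ++ (reverse K_n · 1) ++ (K_n · 2), so that
   K_1 = [[0],[1],[2]]. -/
def Kn : ℕ → List (List (Fin 3))
  | 0 => [[]]
  | n+1 => (Kn n).map (· ++ [0]) ++ ((Kn n).reverse.map (· ++ [1])) ++ (Kn n).map (· ++ [2])

theorem amap_involutive {i j : Fin 3} (h : i ≠ j) : Function.Involutive (amap i j) := by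
  intro w
  induction w with
  | nil => rfl
  | cons x w ih =>
    by_cases hi : x = i
    · simp [amap, hi, h.symm]
    · by_cases hj : x = j
      · simp [amap, hj, h.symm]
      · simp [amap, hi, hj, ih]

theorem amap_replicate_append {i j x : Fin 3} (hi : x ≠ i) (hj : x ≠ j) (n : ℕ)
    (w : List (Fin 3)) :
    amap i j (List.replicate n x ++ w) = List.replicate n x ++ amap i j w := by
  induction n with
  | zero => rfl
  | succ n ih => simp [List.replicate_succ, amap, hi, hj, ih]

theorem length_Kn (n : ℕ) : (Kn n).length = 3 ^ n := by
  induction n with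
  | zero => rfl
  | succ n ih => simp [Kn, ih, pow_succ]; ring

theorem Kn_succ_getD_left {n k : ℕ} (hk : k < 3 ^ n) :
    (Kn (n + 1)).getD k [] = (Kn n).getD k [] ++ [0] := by
  have hl := length_Kn n
  simp [Kn, List.getD_eq_getElem?_getD, List.getElem?_append, hl, hk]

theorem Kn_succ_getD_middle {n k : ℕ} (hk : k < 3 ^ n) :
    (Kn (n + 1)).getD (3 ^ n + k) [] = (Kn n).getD (3 ^ n - 1 - k) [] ++ [1] := by
  have hl := length_Kn n
  simp [Kn, List.getD_eq_getElem?_getD, List.getElem?_append, hl, hk,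
    show 3 ^ n - 1 - k < 3 ^ n by omega]

theorem Kn_succ_getD_right {n k : ℕ} (hk : k < 3 ^ n) :
    (Kn (n + 1)).getD (2 * 3 ^ n + k) [] = (Kn n).getD k [] ++ [2] := by
  have hl := length_Kn n
  simp [Kn, List.getD_eq_getElem?_getD, List.getElem?_append, hl, hk,
    show ¬ 2 * 3 ^ n + k < 3 ^ n by omega,
    show ¬ 2 * 3 ^ n + k - 3 ^ n < 3 ^ n by omega,
    show 2 * 3 ^ n + k - 3 ^ n - 3 ^ n = k by omega]

theorem Kn_getD_zero (n : ℕ) : (Kn n).getD 0 [] = List.replicate n 0 := by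
  induction n with
  | zero => rfl
  | succ n ih => rw [Kn_succ_getD_left (by positivity), ih, List.replicate_succ']

theorem Kn_getD_last (n : ℕ) : (Kn n).getD (3 ^ n - 1) [] = List.replicate n 2 := by
  induction n with
  | zero => rfl
  | succ n ih =>
    have hpos : 0 < 3 ^ n := by positivity
    rw [show 3 ^ (n + 1) - 1 = 2 * 3 ^ n + (3 ^ n - 1) by rw [pow_succ]; omega,
      Kn_succ_getD_right (by omega), ih, List.replicate_succ']

/-- The map leading from the row of index `i` of `Kn n` to the next one. -/
def rowStep (i : ℕ) : List (Fin 3) → List (Fin 3) :=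
  if i % 2 = 0 then amap 0 1 else amap 1 2

theorem rowStep_involutive (i : ℕ) : Function.Involutive (rowStep i) := by
  unfold rowStep
  split_ifs
  · exact amap_involutive (by decide)
  · exact amap_involutive (by decide)

theorem rowStep_congr {i j : ℕ} (h : i % 2 = j % 2) : rowStep i = rowStep j := by
  simp [rowStep, h]

/-- The suffix `s` records that each step changes a letter of the row itself. -/
theorem Kn_getD_succ_append (n : ℕ) :
    ∀ i : ℕ, i + 1 < 3 ^ n → ∀ s : List (Fin 3),
      (Kn n).getD (i + 1) [] ++ s = rowStep i ((Kn n).getD i [] ++ s) := by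
  induction n with
  | zero => intro i hi; simp at hi
  | succ n ih =>
    intro i hi s
    have hodd : 3 ^ n % 2 = 1 := Nat.odd_iff.mp (Odd.pow (by decide))
    have hfirst := Kn_getD_zero n
    have hlast := Kn_getD_last n
    rw [pow_succ] at hi
    rcases lt_trichotomy (i + 1) (3 ^ n) with h | h | h
    · rw [Kn_succ_getD_left h, Kn_succ_getD_left (by omega), List.append_assoc,
        List.append_assoc, ih i h]
    · obtain rfl : i = 3 ^ n - 1 := by omega
      have hmid := Kn_succ_getD_middle (n := n) (k := 0) (by omega)
      rw [add_zero, Nat.sub_zero] at hmid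
      rw [h, hmid, Kn_succ_getD_left (by omega), hlast, List.append_assoc, List.append_assoc,
        rowStep, if_pos (by omega), amap_replicate_append (by decide) (by decide)]
      simp [amap]
    · rcases lt_trichotomy (i + 1) (2 * 3 ^ n) with h' | h' | h'
      · obtain ⟨k, rfl⟩ := Nat.exists_eq_add_of_le (show 3 ^ n ≤ i by omega)
        rw [add_assoc, Kn_succ_getD_middle (by omega), Kn_succ_getD_middle (by omega),
          List.append_assoc, List.append_assoc,
          show 3 ^ n - 1 - k = 3 ^ n - 1 - (k + 1) + 1 by omega, ih _ (by omega),
          rowStep_congr (show (3 ^ n + k) % 2 = (3 ^ n - 1 - (k + 1)) % 2 by omega),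
          rowStep_involutive]
      · obtain rfl : i = 3 ^ n + (3 ^ n - 1) := by omega
        have hright := Kn_succ_getD_right (n := n) (k := 0) (by omega)
        rw [add_zero] at hright
        rw [h', hright, Kn_succ_getD_middle (by omega), Nat.sub_self, hfirst,
          List.append_assoc, List.append_assoc, rowStep, if_neg (by omega),
          amap_replicate_append (by decide) (by decide)]
        simp [amap]
      · obtain ⟨k, rfl⟩ := Nat.exists_eq_add_of_le (show 2 * 3 ^ n ≤ i by omega)
        rw [add_assoc, Kn_succ_getD_right (by omega), Kn_succ_getD_right (by omega),
          List.append_assoc, List.append_assoc, ih k (by omega),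
          rowStep_congr (show (2 * 3 ^ n + k) % 2 = k % 2 by omega)]

/-- Successive rows of K_n are obtained by alternately applying a = a_{01}
    (at even steps) and c = a_{12} (at odd steps). -/
theorem stmt_11 :
    ∀ n : ℕ, 1 ≤ n → ∀ i : ℕ, i + 1 < 3^n →
      (i % 2 = 0 → (Kn n).getD (i+1) [] = amap 0 1 ((Kn n).getD i [])) ∧
      (i % 2 = 1 → (Kn n).getD (i+1) [] = amap 1 2 ((Kn n).getD i [])) := by
  intro n _ i hi
  have h := Kn_getD_succ_append n i hi []
  rw [List.append_nil, List.append_nil, rowStep] at h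
  constructor
  · intro hi0
    rwa [if_pos hi0] at h
  · intro hi1
    rwa [if_neg (by omega)] at h
end

section
/- The maps a = a_{01} and c = a_{12} satisfy a ∘ a = id and c ∘ c = id on List (Fin 3), and for every j ≥ 1 the j-fold composition (c ∘ a)^j is not the identity map. (Hence the group of ternary tree automorphisms generated by a and c is the infinite dihedral group D_∞.) -/
theorem amap_amap {i j : Fin 3} (w : List (Fin 3)) : amap i j (amap i j w) = w := by
  induction w with
  | nil => rfl
  | cons x w ih =>
    simp only [amap]
    split_ifs with hi hj
    · by_cases hji : j = i <;> simp [amap, hi, hji]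
    · simp [amap, hj]
    · simp [amap, hi, hj, ih]

theorem comp_amap_zero_cons (w : List (Fin 3)) :
    (amap 1 2 ∘ amap 0 1) (0 :: w) = 2 :: w := by
  simp [amap]

theorem comp_amap_one_cons (w : List (Fin 3)) :
    (amap 1 2 ∘ amap 0 1) (1 :: w) = 0 :: amap 1 2 w := by
  simp [amap]

theorem comp_amap_two_cons (w : List (Fin 3)) :
    (amap 1 2 ∘ amap 0 1) (2 :: w) = 1 :: amap 0 1 w := by
  simp [amap]

theorem comp_amap_iterate_three_mul (k : ℕ) (w : List (Fin 3)) :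
    (amap 1 2 ∘ amap 0 1)^[3 * k] (0 :: w) = 0 :: (amap 1 2 ∘ amap 0 1)^[k] w := by
  induction k generalizing w with
  | zero => rfl
  | succ k ih =>
    rw [Nat.mul_succ, Function.iterate_add_apply, Function.iterate_succ_apply _ k, ← ih]
    simp only [Function.iterate_succ_apply, Function.iterate_zero_apply, comp_amap_zero_cons,
      comp_amap_two_cons, comp_amap_one_cons, Function.comp_apply (f := amap 1 2) (x := w)]

theorem comp_amap_iterate_ne_id (j : ℕ) (hj : 1 ≤ j) :
    (amap 1 2 ∘ amap 0 1)^[j] ≠ id := by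
  induction j using Nat.strong_induction_on with
  | _ j ih =>
    intro h
    have hw (w : List (Fin 3)) : (amap 1 2 ∘ amap 0 1)^[j % 3]
        (0 :: (amap 1 2 ∘ amap 0 1)^[j / 3] w) = 0 :: w := by
      rw [← comp_amap_iterate_three_mul, ← Function.iterate_add_apply, Nat.mod_add_div, h, id]
    have hlt : j % 3 < 3 := Nat.mod_lt _ (by norm_num)
    interval_cases hr : j % 3
    · exact ih (j / 3) (by omega) (by omega) (funext fun w => (List.cons.inj (hw w)).2)
    · have h0 := hw []
      rw [Function.iterate_one, comp_amap_zero_cons] at h0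
      simp at h0
    · have h0 := hw []
      rw [Function.iterate_succ_apply, Function.iterate_one, comp_amap_zero_cons,
        comp_amap_two_cons] at h0
      simp at h0

/-- a and c are involutions and c∘a has infinite order: ⟨a, c⟩ is the
    infinite dihedral group D_∞. -/
theorem stmt_12 :
    amap 0 1 ∘ amap 0 1 = id ∧
    amap 1 2 ∘ amap 1 2 = id ∧
    ∀ j : ℕ, 1 ≤ j → (amap 1 2 ∘ amap 0 1)^[j] ≠ id :=
  ⟨funext amap_amap, funext amap_amap, comp_amap_iterate_ne_id⟩
end

section
/- For every n ≥ 1 and every index i with 0 ≤ i < 2ⁿ − 1: if i is even then M_n[i+1] = f(M_n[i]), and if i is odd then M_n[i+1] = g(M_n[i]). (Equivalently, M_n[i] = s_i(M_n[0]) where s_{2j} = (g∘f)^j and s_{2j+1} = f∘(g∘f)^j; the binary tree automorphisms f and g generate the infinite dihedral group.) -/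
/- The lists M_n of binary words of length n: M_0 = [ε],
   M_{n+1} = (M_n · 0) ++ (reverse M_n · 1), so that M_1 = [[0],[1]]. -/
def Mn : ℕ → List (List (Fin 2))
  | 0 => [[]]
  | n+1 => (Mn n).map (· ++ [0]) ++ ((Mn n).reverse.map (· ++ [1]))

/- The states f and g of the invertible binary transducer A_D:
   f flips the first letter, g(0·w) = 0·g(w), g(1·w) = 1·f(w). -/
def fD : List (Fin 2) → List (Fin 2)
  | [] => []
  | x :: w => (if x = 0 then 1 else 0) :: w

def gD : List (Fin 2) → List (Fin 2)
  | [] => []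
  | x :: w => if x = 0 then 0 :: gD w else 1 :: fD w

theorem fD_append (w l : List (Fin 2)) (h : fD w ≠ w) : fD (w ++ l) = fD w ++ l := by
  cases w with
  | nil => exact absurd rfl h
  | cons x w => rfl

theorem gD_append (w l : List (Fin 2)) (h : gD w ≠ w) : gD (w ++ l) = gD w ++ l := by
  induction w with
  | nil => exact absurd rfl h
  | cons x w ih =>
    by_cases hx : x = 0
    · subst hx
      have hw : gD w ≠ w := fun e => h (by simp [gD, e])
      simp [gD, ih hw]
    · have h1 : x = 1 := by omega
      subst h1
      have hw : fD w ≠ w := fun e => h (by simp [gD, e])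
      simp [gD, fD_append w l hw]

theorem fD_fD (w : List (Fin 2)) : fD (fD w) = w := by
  cases w with
  | nil => rfl
  | cons x w => fin_cases x <;> rfl

theorem gD_gD (w : List (Fin 2)) : gD (gD w) = w := by
  induction w with
  | nil => rfl
  | cons x w ih => fin_cases x <;> simp [gD, fD_fD, ih]

theorem gD_replicate_zero_append (n : ℕ) (l : List (Fin 2)) :
    gD (List.replicate n 0 ++ l) = List.replicate n 0 ++ gD l := by
  induction n with
  | zero => rfl
  | succ n ih => simp [List.replicate_succ, gD, ih]

/-- The transducer state applied at step `i`: `fD` at even steps, `gD` at odd ones. -/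
def stepD (i : ℕ) : List (Fin 2) → List (Fin 2) := if i % 2 = 0 then fD else gD

theorem stepD_append (i : ℕ) (w l : List (Fin 2)) (h : stepD i w ≠ w) :
    stepD i (w ++ l) = stepD i w ++ l := by
  unfold stepD at *
  split_ifs at * with hi
  · exact fD_append w l h
  · exact gD_append w l h

theorem stepD_stepD (i : ℕ) (w : List (Fin 2)) : stepD i (stepD i w) = w := by
  unfold stepD
  split_ifs
  · exact fD_fD w
  · exact gD_gD w

theorem stepD_congr {i j : ℕ} (h : i % 2 = j % 2) : stepD i = stepD j := by
  simp [stepD, h]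

theorem length_Mn (n : ℕ) : (Mn n).length = 2 ^ n := by
  induction n with
  | zero => rfl
  | succ n ih => simp [Mn, ih, pow_succ]; omega

theorem getD_Mn_succ_left (n i : ℕ) (hi : i < 2 ^ n) :
    (Mn (n + 1)).getD i [] = (Mn n).getD i [] ++ [0] := by
  have hi' : i < (Mn n).length := by rwa [length_Mn]
  simp [Mn, List.getElem?_append_left, hi']

theorem getD_Mn_succ_right (n j k : ℕ) (h : j + k + 1 = 2 ^ n) :
    (Mn (n + 1)).getD (2 ^ n + j) [] = (Mn n).getD k [] ++ [1] := by
  have hl := length_Mn n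
  have hj : j < (Mn n).length := by omega
  have hk : k < (Mn n).length := by omega
  have e : 2 ^ n - 1 - j = k := by omega
  simp [Mn, List.getElem?_append_right, hl, -List.map_reverse, List.getElem?_reverse hj, e,
    List.getElem?_eq_getElem hk]

theorem getD_Mn_zero (n : ℕ) : (Mn n).getD 0 [] = List.replicate n 0 := by
  induction n with
  | zero => rfl
  | succ n ih => rw [getD_Mn_succ_left n 0 (by positivity), ih, List.replicate_succ']

theorem getD_Mn_last (n k : ℕ) (hk : k + 1 = 2 ^ (n + 1)) :
    (Mn (n + 1)).getD k [] = List.replicate n 0 ++ [1] := by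
  obtain ⟨j, rfl⟩ : ∃ j, k = 2 ^ n + j :=
    Nat.exists_eq_add_of_le (by have := Nat.one_le_two_pow (n := n); omega)
  rw [getD_Mn_succ_right n j 0 (by omega), getD_Mn_zero]

theorem getD_Mn_succ_index (n i : ℕ) (hi : i + 1 < 2 ^ (n + 1)) :
    (Mn (n + 1)).getD (i + 1) [] = stepD i ((Mn (n + 1)).getD i []) ∧
      (Mn (n + 1)).getD (i + 1) [] ≠ (Mn (n + 1)).getD i [] := by
  induction n generalizing i with
  | zero =>
    obtain rfl : i = 0 := by omega
    decide
  | succ n ih =>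
    rcases lt_trichotomy (i + 1) (2 ^ (n + 1)) with h | h | h
    · obtain ⟨h1, h2⟩ := ih i h
      rw [getD_Mn_succ_left _ _ h, getD_Mn_succ_left _ i (by omega),
        stepD_append _ _ _ (h1 ▸ h2), ← h1]
      exact ⟨rfl, fun e => h2 (List.append_cancel_right e)⟩
    · have hodd : ¬ i % 2 = 0 := by omega
      have hr := getD_Mn_succ_right (n + 1) 0 i (by omega)
      rw [add_zero, ← h] at hr
      rw [hr, getD_Mn_succ_left (n + 1) i (by omega), getD_Mn_last n i h, stepD, if_neg hodd]
      simp [gD_replicate_zero_append, gD, fD]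
    · obtain ⟨j, rfl⟩ := Nat.exists_eq_add_of_le (Nat.le_of_lt_succ h)
      obtain ⟨k, hk⟩ : ∃ k, j + 1 + k + 1 = 2 ^ (n + 1) :=
        ⟨2 ^ (n + 1) - (j + 2), by omega⟩
      obtain ⟨h1, h2⟩ := ih k (by omega)
      have h3 := stepD_stepD k ((Mn (n + 1)).getD k [])
      rw [← h1] at h3
      rw [add_assoc _ j 1, getD_Mn_succ_right _ (j + 1) k hk,
        getD_Mn_succ_right _ j (k + 1) (by omega),
        stepD_congr (show (2 ^ (n + 1) + j) % 2 = k % 2 by omega),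
        stepD_append _ _ _ (h3 ▸ h2.symm), h3]
      exact ⟨rfl, fun e => h2 (List.append_cancel_right e).symm⟩

/-- Successive rows of M_n are obtained by alternately applying f (at even
    steps) and g (at odd steps). -/
theorem stmt_15 :
    ∀ n : ℕ, 1 ≤ n → ∀ i : ℕ, i + 1 < 2^n →
      (i % 2 = 0 → (Mn n).getD (i+1) [] = fD ((Mn n).getD i [])) ∧
      (i % 2 = 1 → (Mn n).getD (i+1) [] = gD ((Mn n).getD i [])) := by
  intro n hn i hi
  obtain ⟨n, rfl⟩ := Nat.exists_eq_add_of_le' hn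
  have h := (getD_Mn_succ_index n i hi).1
  exact ⟨fun e => by rw [h, stepD, if_pos e], fun e => by rw [h, stepD, if_neg (by omega)]⟩
end
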